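/- The first Fourier coefficient of the squared separation of the primaries equals minus twice the Bessel value: a_{1,1} = (1/2π)∫₀^{2π} (1 − cos E(σ))² e^{−iσ} dσ = −2·J₁(1), where J₁(1) = (1/π)∫₀^{π} cos(θ − sin θ) dθ; moreover J₁(1) > 0, so a_{1,1} ≠ 0. -/

import Mathlib

/- STATEMENT 11: the first Fourier coefficient of ρ² equals −2·J₁(1), and
J₁(1) > 0 (so in particular a_{1,1} ≠ 0). -/

open Real MeasureTheory

/-- The inverse of Kepler's equation `u ↦ u - sin u`. -/
noncomputable def keplerE : ℝ → ℝ := Function.invFun (fun u : ℝ => u - Real.sin u)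

/-- The Bessel value `J₁(1) = (1/π)∫₀^π cos(θ − sin θ) dθ`. -/
noncomputable def J1one : ℝ :=
  (1 / Real.pi) * ∫ θ in (0 : ℝ)..Real.pi, Real.cos (θ - Real.sin θ)

lemma kep_hasDeriv (u : ℝ) : HasDerivAt (fun u : ℝ => u - Real.sin u) (1 - Real.cos u) u :=
  (hasDerivAt_id u).sub (Real.hasDerivAt_sin u)

lemma kep_strictMono : StrictMono (fun u : ℝ => u - Real.sin u) := by
  intro a b hab
  show a - Real.sin a < b - Real.sin b
  have h := Real.sin_sub_sin b a
  have h1 : Real.sin ((b - a) / 2) < (b - a) / 2 := Real.sin_lt (by linarith)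
  have h2 : -((b - a) / 2) < Real.sin ((b - a) / 2) := by
    have := Real.lt_sin (x := -((b - a) / 2)) (by linarith)
    rw [Real.sin_neg] at this
    have h0 : 0 < (b - a) / 2 := by linarith
    by_cases hp : (b - a) / 2 ≤ Real.pi
    · linarith [Real.sin_nonneg_of_nonneg_of_le_pi h0.le hp]
    · linarith [Real.neg_one_le_sin ((b - a) / 2), Real.pi_gt_three]
  have h3 := Real.neg_one_le_cos ((b + a) / 2)
  have h4 := Real.cos_le_one ((b + a) / 2)
  have h5 : Real.sin ((b - a) / 2) * Real.cos ((b + a) / 2) < (b - a) / 2 := by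
    have h6 : |Real.sin ((b - a) / 2)| < (b - a) / 2 := abs_lt.mpr ⟨h2, h1⟩
    have h7 : |Real.cos ((b + a) / 2)| ≤ 1 := Real.abs_cos_le_one _
    have h8 := le_abs_self (Real.sin ((b - a) / 2) * Real.cos ((b + a) / 2))
    rw [abs_mul] at h8
    have h9 := mul_le_of_le_one_right (abs_nonneg (Real.sin ((b - a) / 2))) h7
    linarith
  linarith

lemma kep_surj : Function.Surjective (fun u : ℝ => u - Real.sin u) := by
  intro y
  have hc : Continuous (fun u : ℝ => u - Real.sin u) := by fun_prop
  have := intermediate_value_Icc (show y - 1 ≤ y + 1 by linarith) hc.continuousOn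
  obtain ⟨x, -, hx⟩ := this (show y ∈ _ from
    ⟨by have := Real.neg_one_le_sin (y - 1); linarith,
     by have := Real.sin_le_one (y + 1); linarith⟩)
  exact ⟨x, hx⟩

lemma keplerE_left (u : ℝ) : keplerE (u - Real.sin u) = u :=
  Function.leftInverse_invFun kep_strictMono.injective u

lemma keplerE_continuous : Continuous keplerE := by
  let e := StrictMono.orderIsoOfSurjective _ kep_strictMono kep_surj
  have : keplerE = e.symm := by
    funext y
    obtain ⟨x, rfl⟩ := kep_surj y
    rw [keplerE_left]
    exact (e.symm_apply_apply x).symm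
  rw [this]
  exact e.symm.continuous

noncomputable def kepW (u : ℝ) : ℂ := Complex.exp (-Complex.I * ((u - Real.sin u : ℝ) : ℂ))

lemma kepW_hasDeriv (u : ℝ) :
    HasDerivAt kepW (kepW u * (-Complex.I * ((1 - Real.cos u : ℝ) : ℂ))) u :=
  (((kep_hasDeriv u).ofReal_comp).const_mul (-Complex.I)).cexp

lemma kepW_cont : Continuous kepW := by unfold kepW; fun_prop

lemma kepW_zero : kepW 0 = 1 := by simp [kepW]

lemma kepW_two_pi : kepW (2 * Real.pi) = 1 := by
  simp only [kepW, Real.sin_two_pi, sub_zero]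
  rw [Complex.exp_eq_one_iff]
  exact ⟨-1, by push_cast; ring⟩

lemma kepW_reflect (u : ℝ) : kepW (2 * Real.pi - u) + kepW u
    = ((2 * Real.cos (u - Real.sin u) : ℝ) : ℂ) := by
  have h : kepW (2 * Real.pi - u) = Complex.exp (((u - Real.sin u : ℝ) : ℂ) * Complex.I) := by
    rw [kepW, Real.sin_two_pi_sub, Complex.exp_eq_exp_iff_exists_int]
    exact ⟨-1, by push_cast; ring⟩
  rw [h, kepW]
  push_cast
  rw [Complex.two_cos]
  congr 2
  ring

lemma kep_change : (∫ σ in (0 : ℝ)..(2 * Real.pi),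
      (((1 - Real.cos (keplerE σ)) ^ 2 : ℝ) : ℂ) * Complex.exp (-Complex.I * σ))
    = ∫ u in (0 : ℝ)..(2 * Real.pi), (((1 - Real.cos u) ^ 3 : ℝ) : ℂ) * kepW u := by
  have hg : Continuous (fun σ : ℝ =>
      (((1 - Real.cos (keplerE σ)) ^ 2 : ℝ) : ℂ) * Complex.exp (-Complex.I * σ)) := by
    have := keplerE_continuous
    fun_prop
  have := intervalIntegral.integral_deriv_smul_comp (a := 0) (b := 2 * Real.pi)
    (fun x _ => kep_hasDeriv x) (by fun_prop) hg
  simp only [Real.sin_zero, Real.sin_two_pi, sub_zero] at this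
  rw [← this]
  congr 1
  funext u
  simp only [Function.comp, keplerE_left, kepW, Complex.real_smul]
  push_cast
  ring

lemma kep_parts : (∫ u in (0 : ℝ)..(2 * Real.pi), (((1 - Real.cos u) ^ 3 : ℝ) : ℂ) * kepW u)
    = -2 * ∫ u in (0 : ℝ)..(2 * Real.pi), kepW u := by
  have hW := kepW_cont
  have hF : ∀ u : ℝ, HasDerivAt (fun u : ℝ =>
      (Complex.I * (((1 - Real.cos u) ^ 2 : ℝ) : ℂ) + ((2 * Real.sin u : ℝ) : ℂ)
        + 2 * Complex.I) * kepW u)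
      ((((1 - Real.cos u) ^ 3 : ℝ) : ℂ) * kepW u + 2 * kepW u) u := by
    intro u
    have h1 : HasDerivAt (fun u : ℝ => (1 - Real.cos u) ^ 2) (2 * (1 - Real.cos u) * Real.sin u) u := by
      have := (((Real.hasDerivAt_cos u).const_sub 1).fun_pow 2)
      refine this.congr_deriv ?_
      push_cast; ring
    have h2 := (Real.hasDerivAt_sin u).const_mul 2
    have := (((h1.ofReal_comp.const_mul Complex.I).add h2.ofReal_comp).add_const
      (2 * Complex.I)).mul (kepW_hasDeriv u)
    refine HasDerivAt.congr_deriv this ?_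
    simp only [Pi.add_apply]
    push_cast
    linear_combination (-(1 - Complex.cos u)^3 * kepW u - 2 * (1 - Complex.cos u) * kepW u) * Complex.I_sq
  have := intervalIntegral.integral_eq_sub_of_hasDerivAt (a := 0) (b := 2 * Real.pi)
    (fun x _ => hF x) (Continuous.intervalIntegrable (by fun_prop) _ _)
  rw [intervalIntegral.integral_add (Continuous.intervalIntegrable (by fun_prop) _ _)
    (Continuous.intervalIntegrable (by fun_prop) _ _), intervalIntegral.integral_const_mul] at this
  simp only [kepW_zero, kepW_two_pi, Real.cos_zero, Real.cos_two_pi, Real.sin_zero,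
    Real.sin_two_pi, sub_self] at this
  linear_combination this

lemma kep_W_integral : (∫ u in (0 : ℝ)..(2 * Real.pi), kepW u)
    = ((2 * ∫ u in (0 : ℝ)..Real.pi, Real.cos (u - Real.sin u) : ℝ) : ℂ) := by
  have hW := kepW_cont
  have h1 := intervalIntegral.integral_comp_sub_left (a := 0) (b := Real.pi) kepW (2 * Real.pi)
  rw [← intervalIntegral.integral_add_adjacent_intervals (b := Real.pi)
    (hW.intervalIntegrable _ _) (hW.intervalIntegrable _ _)]
  rw [show 2 * Real.pi - Real.pi = Real.pi by ring, sub_zero] at h1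
  rw [← h1, add_comm, ← intervalIntegral.integral_add
    (Continuous.intervalIntegrable (by fun_prop) _ _) (hW.intervalIntegrable _ _)]
  simp only [kepW_reflect]
  rw [intervalIntegral.integral_ofReal, intervalIntegral.integral_const_mul]

lemma kep_pos : 0 < ∫ u in (0 : ℝ)..Real.pi, Real.cos (u - Real.sin u) := by
  have h1 := intervalIntegral.integral_comp_sub_left (a := 0) (b := Real.pi)
    (fun u => Real.cos (u - Real.sin u)) Real.pi
  simp only [sub_self, sub_zero] at h1
  have h2 : (∫ u in (0 : ℝ)..Real.pi, 2 * (Real.sin u * Real.sin (Real.sin u)))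
      = 2 * ∫ u in (0 : ℝ)..Real.pi, Real.cos (u - Real.sin u) := by
    rw [two_mul (∫ u in (0 : ℝ)..Real.pi, Real.cos (u - Real.sin u))]
    nth_rewrite 2 [← h1]
    rw [← intervalIntegral.integral_add
      (Continuous.intervalIntegrable (by fun_prop) _ _)
      (Continuous.intervalIntegrable (by fun_prop) _ _)]
    congr 1
    funext u
    rw [Real.sin_pi_sub, show Real.pi - u - Real.sin u = Real.pi - (u + Real.sin u) by ring,
      Real.cos_pi_sub, Real.cos_sub, Real.cos_add]
    ring
  have h3 : 0 < ∫ u in (0 : ℝ)..Real.pi, 2 * (Real.sin u * Real.sin (Real.sin u)) := by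
    apply intervalIntegral.intervalIntegral_pos_of_pos_on
      (Continuous.intervalIntegrable (by fun_prop) _ _) _ Real.pi_pos
    intro x hx
    have hs := Real.sin_pos_of_pos_of_lt_pi hx.1 hx.2
    have := Real.sin_pos_of_pos_of_lt_pi hs
      (by have := Real.sin_le_one x; have := Real.pi_gt_three; linarith)
    positivity
  linarith

theorem first_fourier_coefficient_rho_sq :
    ((1 / (2 * Real.pi) : ℂ) *
        ∫ σ in (0 : ℝ)..(2 * Real.pi),
          (((1 - Real.cos (keplerE σ)) ^ 2 : ℝ) : ℂ) * Complex.exp (-Complex.I * σ))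
      = ((-2 * J1one : ℝ) : ℂ) ∧ 0 < J1one := by
  refine ⟨?_, mul_pos (by have := Real.pi_pos; positivity) kep_pos⟩
  rw [kep_change, kep_parts, kep_W_integral, J1one]
  have : (Real.pi : ℂ) ≠ 0 := by exact_mod_cast Real.pi_ne_zero
  push_cast
  field_simp
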